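/- Let T_1,...,T_d be commuting measure-preserving ℤ^r-actions on a standard Borel probability space (X,Σ,μ), and let μ^{*d} be the Furstenberg self-joining with coordinate projections π_1,...,π_d and the action S_{d+1} = T_1×...×T_d on (X^d, Σ^{⊗d}, μ^{*d}). Suppose f_1 ∈ L^∞(μ) satisfies ∫_{X^d} (f_1∘π_1) · (∏_{i=2}^d f_i∘π_i) · g dμ^{*d} = 0 for every f_2,...,f_d ∈ L^∞(μ) and every S_{d+1}-invariant g ∈ L^∞(μ^{*d}). Then for every f_2,...,f_d ∈ L^∞(μ), every Følner sequence (I_N) in ℤ^r and every base-point sequence (a_N), (1/|I_N|) Σ_{n ∈ I_N + a_N} ∏_{i=1}^d f_i∘T_i^n → 0 in L^2(μ). -/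

import Mathlib

open MeasureTheory Filter Finset
open scoped symmDiff ENNReal

theorem fca_hilbert {E G : Type*} [NormedAddCommGroup E] [InnerProductSpace ℝ E] [CompleteSpace E]
    [AddMonoid G] (U : G → E →ₗᵢ[ℝ] E) (v : E) (hU : ∀ n m, U n (U m v) = U (n + m) v) :
    ∃ g ∈ closure (convexHull ℝ (Set.range fun n => U n v)),
      (∀ n, U n g = g) ∧ ∀ n, ‖g‖ ^ 2 ≤ inner ℝ g (U n v) := by
  set K := closure (convexHull ℝ (Set.range fun n => U n v)) with hK
  have hconv : Convex ℝ K := (convex_convexHull ℝ _).closure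
  have hmem : ∀ n, U n v ∈ K := fun n => subset_closure (subset_convexHull ℝ _ ⟨n, rfl⟩)
  obtain ⟨g, hg, hmin⟩ := exists_norm_eq_iInf_of_complete_convex (K := K) ⟨_, hmem 0⟩
    isClosed_closure.isComplete hconv 0
  have key := (norm_eq_iInf_iff_real_inner_le_zero hconv hg).1 hmin
  have key' : ∀ w ∈ K, ‖g‖ ^ 2 ≤ inner ℝ g w := by
    intro w hw
    have := key w hw
    rw [zero_sub, inner_neg_left, inner_sub_right, real_inner_self_eq_norm_sq] at this
    linarith
  refine ⟨g, hg, fun n => ?_, fun n => key' _ (hmem n)⟩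
  have hmaps : Set.MapsTo (U n) K K := by
    refine Set.MapsTo.closure ?_ (U n).continuous
    have h1 := (U n).toLinearMap.image_convexHull (Set.range fun n => U n v)
    intro x hx
    have h2 : U n x ∈ (U n).toLinearMap '' convexHull ℝ (Set.range fun n => U n v) := ⟨x, hx, rfl⟩
    rw [h1] at h2
    refine convexHull_mono ?_ h2
    rintro _ ⟨_, ⟨m, rfl⟩, rfl⟩
    exact ⟨n + m, (hU n m).symm⟩
  have h3 := key' _ (hmaps hg)
  have h4 := norm_sub_sq_real g (U n g)
  rw [(U n).norm_map] at h4
  have h5 : ‖g - U n g‖ ^ 2 ≤ 0 := by linarith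
  have h6 : ‖g - U n g‖ = 0 := by
    have := sq_nonneg (‖g - U n g‖)
    exact pow_eq_zero_iff (two_ne_zero) |>.1 (le_antisymm h5 this)
  exact (sub_eq_zero.1 (norm_eq_zero.1 h6)).symm

theorem fca_boundary {G : Type*} [AddCommGroup G] [DecidableEq G] (I : Finset G) (h : G) (u : G → ℝ)
    (C : ℝ) (hu : ∀ n, |u n| ≤ C) :
    |∑ n ∈ I, u n - ∑ n ∈ I, u (n + h)| ≤ C * (((I.image (· + h)) ∆ I).card : ℝ) := by
  have h1 : ∑ n ∈ I, u (n + h) = ∑ m ∈ I.image (· + h), u m := by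
    rw [Finset.sum_image]
    intro x _ y _ hxy
    exact add_right_cancel hxy
  rw [h1, ← Finset.sum_sdiff_sub_sum_sdiff]
  have h2 : ∀ J : Finset G, |∑ n ∈ J, u n| ≤ C * J.card := by
    intro J
    refine (Finset.abs_sum_le_sum_abs _ _).trans ((Finset.sum_le_sum fun n _ => hu n).trans ?_)
    simp [mul_comm]
  refine (abs_sub _ _).trans ((add_le_add (h2 _) (h2 _)).trans (le_of_eq ?_))
  rw [symmDiff_def, Finset.sup_eq_union, Finset.card_union_of_disjoint disjoint_sdiff_sdiff]
  push_cast; ring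

theorem fca_inv {X : Type*} [MeasurableSpace X]
    (d : ℕ) (ν : Measure (Fin d → X)) [IsProbabilityMeasure ν]
    (S : Fin d → X → X) (hS : ∀ i, Measurable (S i))
    (h : ∀ g : Fin d → X → ℝ, (∀ i, Measurable (g i)) →
      (∀ i, ∃ C : ℝ, ∀ x, |g i x| ≤ C) →
      ∫ y, ∏ i, g i (S i (y i)) ∂ν = ∫ y, ∏ i, g i (y i) ∂ν) :
    MeasurePreserving (fun (y : Fin d → X) i => S i (y i)) ν ν := by
  have hm : Measurable (fun (y : Fin d → X) i => S i (y i)) := by fun_prop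
  refine ⟨hm, ?_⟩
  have := Measure.isProbabilityMeasure_map (μ := ν) hm.aemeasurable
  refine ext_of_generate_finite _ generateFrom_pi.symm isPiSystem_pi ?_ (by simp)
  rintro _ ⟨s, hs, rfl⟩
  have hs' : ∀ i, MeasurableSet (s i) := fun i => hs i (Set.mem_univ i)
  have hms : MeasurableSet (Set.univ.pi s) := MeasurableSet.univ_pi hs'
  have h1 := h (fun i => (s i).indicator 1) (fun i => measurable_one.indicator (hs' i))
    (fun i => ⟨1, fun x => by
      by_cases hx : x ∈ s i <;> simp [hx]⟩)
  have h2 : ∀ y : Fin d → X, ∏ i, (s i).indicator (1 : X → ℝ) (y i)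
      = (Set.univ.pi s).indicator (1 : (Fin d → X) → ℝ) y := by
    intro y
    by_cases hy : y ∈ Set.univ.pi s
    · rw [Set.indicator_of_mem hy]
      exact Finset.prod_eq_one fun i _ => by simp [hy i (Set.mem_univ i)]
    · rw [Set.indicator_of_notMem hy]
      simp only [Set.mem_pi, Set.mem_univ, true_implies, not_forall] at hy
      obtain ⟨i, hi⟩ := hy
      exact Finset.prod_eq_zero (Finset.mem_univ i) (by simp [hi])
  have h3 : ∀ y : Fin d → X, ∏ i, (s i).indicator (1 : X → ℝ) (S i (y i))
      = ((fun (y : Fin d → X) i => S i (y i)) ⁻¹' (Set.univ.pi s)).indicator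
        (1 : (Fin d → X) → ℝ) y := fun y => h2 (fun i => S i (y i))
  rw [integral_congr_ae (ae_of_all ν h3), integral_congr_ae (ae_of_all ν h2)] at h1
  rw [integral_indicator_one (hm hms), integral_indicator_one hms] at h1
  rw [Measure.map_apply hm hms]
  exact (measureReal_eq_measureReal_iff).1 h1

theorem fca_ergodic {Y G : Type*} [MeasurableSpace Y] (ν : Measure Y) [IsProbabilityMeasure ν]
    [AddCommMonoid G] (S : G → Y → Y) (hS : ∀ n, MeasurePreserving (S n) ν ν)
    (h0 : ∀ y, S 0 y = y)
    (hadd : ∀ n m y, S (n + m) y = S n (S m y)) (Φ : Y → ℝ) (hΦ : Measurable Φ)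
    (C : ℝ) (hC : ∀ y, |Φ y| ≤ C)
    (horth : ∀ g : Y → ℝ, Measurable g → (∃ C : ℝ, ∀ y, |g y| ≤ C) →
      (∀ n, (fun y => g (S n y)) =ᵐ[ν] g) → ∫ y, Φ y * g y ∂ν = 0) (ε : ℝ) (hε : 0 < ε) :
    ∃ (ι : Type) (t : Finset ι) (w : ι → ℝ) (h : ι → G), (∀ i ∈ t, 0 ≤ w i) ∧
      ∑ i ∈ t, w i = 1 ∧ ∫ y, (∑ i ∈ t, w i * Φ (S (h i) y)) ^ 2 ∂ν < ε := by
  have hmem : MemLp Φ 2 ν := MemLp.of_bound hΦ.aestronglyMeasurable C (ae_of_all _ hC)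
  have hmemS : ∀ n, MemLp (fun y => Φ (S n y)) 2 ν := fun n =>
    MemLp.of_bound (hΦ.comp (hS n).measurable).aestronglyMeasurable C (ae_of_all _ fun y => hC _)
  let v : Lp ℝ 2 ν := hmem.toLp Φ
  let U : G → Lp ℝ 2 ν →ₗᵢ[ℝ] Lp ℝ 2 ν := fun n => Lp.compMeasurePreservingₗᵢ ℝ (S n) (hS n)
  have hUv : ∀ n, U n v = (hmemS n).toLp _ := fun n => rfl
  obtain ⟨g, hg, hinv, hle⟩ := fca_hilbert U v (by
    intro n m
    rw [hUv m, hUv (n + m)]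
    have : U n ((hmemS m).toLp _) = ((hmemS m).comp_measurePreserving (hS n)).toLp _ := rfl
    rw [this]
    congr 1
    funext y
    simp only [Function.comp]
    rw [add_comm, hadd])
  -- boundedness of g
  have hgb : ∀ᵐ y ∂ν, |g y| ≤ C := by
    let B : Set (Lp ℝ 2 ν) := Set.Icc ((memLp_const (-C)).toLp _) ((memLp_const C).toLp _)
    have hBc : IsClosed B := isClosed_Icc
    have hB : ∀ f : Lp ℝ 2 ν, f ∈ B ↔ ∀ᵐ y ∂ν, |f y| ≤ C := by
      intro f
      have e1 := (memLp_const C : MemLp (fun _ : Y => C) 2 ν).coeFn_toLp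
      have e2 := (memLp_const (-C) : MemLp (fun _ : Y => -C) 2 ν).coeFn_toLp
      simp only [B, Set.mem_Icc, ← Lp.coeFn_le]
      constructor
      · rintro ⟨b, a⟩
        filter_upwards [a, b, e1, e2] with y a b e1 e2
        rw [e1] at a; rw [e2] at b
        exact abs_le.2 ⟨b, a⟩
      · intro a
        constructor
        · filter_upwards [a, e2] with y a e2
          rw [e2]; exact (abs_le.1 a).1
        · filter_upwards [a, e1] with y a e1
          rw [e1]; exact (abs_le.1 a).2
    have hBconv : Convex ℝ B := by
      intro f hf g hg a b ha hb hab
      rw [hB] at hf hg ⊢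
      filter_upwards [hf, hg, Lp.coeFn_add (a • f) (b • g), Lp.coeFn_smul a f,
        Lp.coeFn_smul b g] with y hf hg h1 h2 h3
      rw [h1, Pi.add_apply, h2, h3]
      simp only [Pi.smul_apply, smul_eq_mul]
      rw [abs_le] at *
      have : C = a * C + b * C := by rw [← add_mul, hab, one_mul]
      constructor <;> nlinarith
    have hsub : closure (convexHull ℝ (Set.range fun n => U n v)) ⊆ B := by
      refine closure_minimal (convexHull_min ?_ hBconv) hBc
      rintro _ ⟨n, rfl⟩
      rw [hB]
      dsimp only
      rw [hUv]
      filter_upwards [(hmemS n).coeFn_toLp] with y hy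
      rw [hy]; exact hC _
    exact (hB g).1 (hsub hg)
  -- a bounded measurable representative
  obtain ⟨g₀, hg₀m, hgg₀⟩ := (Lp.aestronglyMeasurable g).aemeasurable
  let k : Y → ℝ := fun y => max (-C) (min C (g₀ y))
  have hkm : Measurable k := measurable_const.max (measurable_const.min hg₀m)
  have hgk : g =ᵐ[ν] k := by
    filter_upwards [hgb, hgg₀] with y h1 h2
    rw [abs_le] at h1
    simp only [k, ← h2]
    rw [min_eq_right h1.2, max_eq_right h1.1]
  have hk := horth k hkm ⟨|C|, fun y => by
      simp only [k]
      have := abs_nonneg C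
      have h1 := le_abs_self C
      have h2 := neg_abs_le C
      rw [abs_le]
      constructor
      · exact (neg_le_neg h1).trans (le_max_left _ _)
      · exact max_le (neg_le_abs C) ((min_le_left _ _).trans h1)⟩ (by
    intro n
    have h1 : (U n g : Y → ℝ) =ᵐ[ν] g ∘ S n := Lp.coeFn_compMeasurePreserving g (hS n)
    rw [hinv n] at h1
    have h2 : g ∘ S n =ᵐ[ν] k ∘ S n := (hS n).quasiMeasurePreserving.ae_eq_comp hgk
    exact (h2.symm.trans h1.symm).trans hgk)
  have hin : inner ℝ g v = 0 := by
    rw [L2.inner_def, ← hk]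
    refine integral_congr_ae ?_
    filter_upwards [hgk, hmem.coeFn_toLp] with y h1 h2
    simp only [v]
    rw [h1, h2]
    simp
  have hU0 : U 0 v = v := by
    rw [hUv]
    simp only [v]
    congr 1
    funext y
    rw [h0]
  have hg0 : g = 0 := by
    have := hle 0
    rw [hU0, hin] at this
    exact norm_eq_zero.1 (pow_eq_zero_iff (two_ne_zero) |>.1 (le_antisymm this (sq_nonneg _)))
  rw [hg0, Metric.mem_closure_iff] at hg
  obtain ⟨b, hb, hbd⟩ := hg (Real.sqrt ε) (Real.sqrt_pos.2 hε)
  rw [dist_zero_left] at hbd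
  rw [_root_.convexHull_eq] at hb
  obtain ⟨ι, t, w, z, hw0, hw1, hz, rfl⟩ := hb
  have hz' : ∀ i, ∃ n, i ∈ t → U n v = z i := by
    intro i
    by_cases hi : i ∈ t
    · obtain ⟨n, hn⟩ := hz i hi
      exact ⟨n, fun _ => hn⟩
    · exact ⟨0, fun h => absurd h hi⟩
  choose h hh using hz'
  refine ⟨ι, t, w, h, hw0, hw1, ?_⟩
  have hmemsum : MemLp (fun y => ∑ i ∈ t, w i * Φ (S (h i) y)) 2 ν :=
    memLp_finsetSum t fun i _ => (hmemS (h i)).const_mul (w i)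
  have hcm : t.centerMass w z = hmemsum.toLp _ := by
    rw [Finset.centerMass_eq_of_sum_1 _ _ hw1]
    refine Lp.ext ?_
    have e1 : (⇑(∑ i ∈ t, w i • z i) : Y → ℝ) =ᵐ[ν] ∑ i ∈ t, ⇑(w i • z i) := Lp.coeFn_finsetSum t _
    have e2 : ∀ i ∈ t, ∀ᵐ y ∂ν, (w i • z i : Lp ℝ 2 ν) y = w i * Φ (S (h i) y) := by
      intro i hi
      rw [← hh i hi, hUv]
      filter_upwards [Lp.coeFn_smul (w i) ((hmemS (h i)).toLp _), (hmemS (h i)).coeFn_toLp]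
        with y h1 h2
      rw [h1, Pi.smul_apply, h2, smul_eq_mul]
    have e3 := (ae_ball_iff t.countable_toSet).2 e2
    filter_upwards [e1, e3, hmemsum.coeFn_toLp] with y e1 e3 e4
    rw [e1, e4, Finset.sum_apply]
    exact Finset.sum_congr rfl fun i hi => e3 i hi
  have hnorm : ∫ y, (∑ i ∈ t, w i * Φ (S (h i) y)) ^ 2 ∂ν = ‖t.centerMass w z‖ ^ 2 := by
    rw [hcm, ← real_inner_self_eq_norm_sq, L2.inner_def]
    refine integral_congr_ae ?_
    filter_upwards [hmemsum.coeFn_toLp] with y e4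
    rw [e4]
    simp [sq]
  rw [hnorm]
  calc _ < (Real.sqrt ε) ^ 2 := by gcongr
    _ = ε := Real.sq_sqrt hε.le

/-- The Furstenberg self-joining controls nonconventional averages: let `ν = μ^{*d}`
be the Furstenberg self-joining of commuting `ℤ^r`-actions `T 0, …, T (d-1)` (given
by its defining averaging property), with coordinate projections `π i` and the
off-diagonal action `S_{d+1} = T 0 × ⋯ × T (d-1)`.  If `f₁ ∈ L^∞(μ)` satisfies
`∫ (f₁∘π₀)·(∏_{i≠0} f i∘π i)·g dν = 0` for all `f i ∈ L^∞(μ)` and all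
`S_{d+1}`-invariant `g ∈ L^∞(ν)`, then all the nonconventional averages with first
function `f₁` tend to `0` in `L²(μ)`. -/
theorem furstenberg_controls_averages
    {X : Type*} [MeasurableSpace X]
    (μ : Measure X) [IsProbabilityMeasure μ]
    (r d : ℕ) (hd : 0 < d)
    (T : Fin d → (Fin r → ℤ) → X → X)
    (hmp : ∀ i n, MeasurePreserving (T i n) μ μ)
    (hid : ∀ i x, T i 0 x = x)
    (hadd : ∀ i n m x, T i (n + m) x = T i n (T i m x))
    (hcomm : ∀ i j n m x, T i n (T j m x) = T j m (T i n x))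
    (ν : Measure (Fin d → X)) [IsProbabilityMeasure ν]
    -- `ν` is the Furstenberg self-joining:
    (hν : ∀ g : Fin d → X → ℝ, (∀ i, Measurable (g i)) →
      (∀ i, ∃ C : ℝ, ∀ x, |g i x| ≤ C) →
      ∀ (I : ℕ → Finset (Fin r → ℤ)) (a : ℕ → Fin r → ℤ),
        (∀ N, (I N).Nonempty) →
        (∀ v : Fin r → ℤ, Tendsto
          (fun N => ((((I N).image (· + v)) ∆ (I N)).card : ℝ) / ((I N).card : ℝ))
          atTop (nhds 0)) →
        Tendsto (fun N => ((I N).card : ℝ)⁻¹ *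
            ∑ n ∈ I N, ∫ x, ∏ i, g i (T i (n + a N) x) ∂μ)
          atTop (nhds (∫ y, ∏ i, g i (y i) ∂ν)))
    (f₁ : X → ℝ) (hf₁ : Measurable f₁) (hf₁b : ∃ C : ℝ, ∀ x, |f₁ x| ≤ C)
    -- orthogonality hypothesis in the self-joining:
    (horth : ∀ f : Fin d → X → ℝ, (∀ i, Measurable (f i)) →
      (∀ i, ∃ C : ℝ, ∀ x, |f i x| ≤ C) →
      ∀ g : (Fin d → X) → ℝ, Measurable g → (∃ C : ℝ, ∀ y, |g y| ≤ C) →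
      (∀ n : Fin r → ℤ, (fun y : Fin d → X => g (fun i => T i n (y i))) =ᵐ[ν] g) →
      ∫ y, f₁ (y ⟨0, hd⟩) *
          (∏ i ∈ Finset.univ.erase (⟨0, hd⟩ : Fin d), f i (y i)) * g y ∂ν = 0) :
    ∀ f : Fin d → X → ℝ, (∀ i, Measurable (f i)) →
      (∀ i, ∃ C : ℝ, ∀ x, |f i x| ≤ C) →
      ∀ (I : ℕ → Finset (Fin r → ℤ)) (a : ℕ → Fin r → ℤ),
        (∀ N, (I N).Nonempty) →
        (∀ v : Fin r → ℤ, Tendsto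
          (fun N => ((((I N).image (· + v)) ∆ (I N)).card : ℝ) / ((I N).card : ℝ))
          atTop (nhds 0)) →
        Tendsto (fun N => eLpNorm (fun x => ((I N).card : ℝ)⁻¹ *
            ∑ n ∈ I N, f₁ (T ⟨0, hd⟩ (n + a N) x) *
              ∏ i ∈ Finset.univ.erase (⟨0, hd⟩ : Fin d), f i (T i (n + a N) x)) 2 μ)
          atTop (nhds 0) := by
  classical
  intro f hf hfb I a hne hfol
  -- the full tuple of functions
  let F : Fin d → X → ℝ := fun i => if i = ⟨0, hd⟩ then f₁ else f i
  have hF0 : F ⟨0, hd⟩ = f₁ := if_pos rfl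
  have hFi : ∀ i ∈ Finset.univ.erase (⟨0, hd⟩ : Fin d), F i = f i := fun i hi =>
    if_neg (Finset.ne_of_mem_erase hi)
  have hFm : ∀ i, Measurable (F i) := by
    intro i
    by_cases h : i = ⟨0, hd⟩
    · simp only [F, h, if_true]; exact hf₁
    · simp only [F, h, if_false]; exact hf i
  have hFb : ∀ i, ∃ C : ℝ, ∀ x, |F i x| ≤ C := by
    intro i
    by_cases h : i = ⟨0, hd⟩
    · simp only [F, h, if_true]; exact hf₁b
    · simp only [F, h, if_false]; exact hfb i
  choose c hc using hFb
  let C : ℝ := ∏ i, c i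
  have hCprod : ∀ y : Fin d → X, |∏ i, F i (y i)| ≤ C := by
    intro y
    rw [Finset.abs_prod]
    exact Finset.prod_le_prod (fun i _ => abs_nonneg _) (fun i _ => hc i _)
  have hsplit : ∀ y : Fin d → X, f₁ (y ⟨0, hd⟩) *
      (∏ i ∈ Finset.univ.erase (⟨0, hd⟩ : Fin d), f i (y i)) = ∏ i, F i (y i) := by
    intro y
    rw [← Finset.mul_prod_erase _ _ (Finset.mem_univ (⟨0, hd⟩ : Fin d)), hF0]
    congr 1
    exact Finset.prod_congr rfl fun i hi => by rw [hFi i hi]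
  let Φ : (Fin d → X) → ℝ := fun y => ∏ i, F i (y i)
  have hΦm : Measurable Φ := by
    refine Finset.measurable_prod _ fun i _ => (hFm i).comp (measurable_pi_apply i)
  let S : (Fin r → ℤ) → (Fin d → X) → (Fin d → X) := fun n y i => T i n (y i)
  have hTm : ∀ i n, Measurable (T i n) := fun i n => (hmp i n).measurable
  have hSmp : ∀ n, MeasurePreserving (S n) ν ν := by
    intro m
    refine fca_inv d ν (fun i => T i m) (fun i => hTm i m) ?_
    intro g hg hgb
    have h1 := hν g hg hgb I (fun N => m + a N) hne hfol
    have h2 := hν (fun i x => g i (T i m x)) (fun i => (hg i).comp (hTm i m))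
      (fun i => (hgb i).imp fun C hC x => hC _) I a hne hfol
    refine tendsto_nhds_unique h2 (h1.congr fun N => ?_)
    congr 1
    refine Finset.sum_congr rfl fun n _ => ?_
    refine integral_congr_ae (ae_of_all _ fun x => ?_)
    refine Finset.prod_congr rfl fun i _ => ?_
    rw [← hadd]
    congr 2
    abel
  let u : (Fin r → ℤ) → X → ℝ := fun n x => ∏ i, F i (T i n x)
  have hum : ∀ n, Measurable (u n) := fun n =>
    Finset.measurable_prod _ fun i _ => (hFm i).comp (hTm i n)
  have hub : ∀ n x, |u n x| ≤ C := fun n x => hCprod (fun i => T i n x)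
  let A : ℕ → X → ℝ := fun N x => ((I N).card : ℝ)⁻¹ * ∑ n ∈ I N, u (n + a N) x
  have hAm : ∀ N, Measurable (A N) := fun N =>
    (Finset.measurable_sum _ fun n _ => hum _).const_mul _
  have hIpos : ∀ N, (0 : ℝ) < (I N).card := fun N => by exact_mod_cast (hne N).card_pos
  have hAb : ∀ N x, |A N x| ≤ C := by
    intro N x
    simp only [A]
    rw [abs_mul, abs_of_pos (inv_pos.2 (hIpos N)), inv_mul_le_iff₀ (hIpos N)]
    refine (Finset.abs_sum_le_sum_abs _ _).trans ((Finset.sum_le_sum fun n _ => hub _ x).trans ?_)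
    simp
  have hgoal : ∀ N, (fun x => ((I N).card : ℝ)⁻¹ *
            ∑ n ∈ I N, f₁ (T ⟨0, hd⟩ (n + a N) x) *
              ∏ i ∈ Finset.univ.erase (⟨0, hd⟩ : Fin d), f i (T i (n + a N) x)) = A N := by
    intro N
    funext x
    simp only [A]
    congr 1
    exact Finset.sum_congr rfl fun n _ => hsplit (fun i => T i (n + a N) x)
  simp only [hgoal]
  -- integral of a bounded measurable function
  have hint : ∀ (g : X → ℝ), Measurable g → ∀ D : ℝ, (∀ x, |g x| ≤ D) → Integrable g μ :=
    fun g hg D hD => Integrable.of_bound hg.aestronglyMeasurable D (ae_of_all _ hD)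
  have huu : ∀ n m, Integrable (fun x => u n x * u m x) μ := fun n m =>
    hint _ ((hum n).mul (hum m)) (C * C) fun x => by
      rw [abs_mul]
      exact mul_le_mul (hub n x) (hub m x) (abs_nonneg _) ((abs_nonneg _).trans (hub n x))
  have hAmem : ∀ N, MemLp (A N) 2 μ := fun N =>
    MemLp.of_bound (hAm N).aestronglyMeasurable C (ae_of_all _ (hAb N))
  have key : Tendsto (fun N => ∫ x, A N x ^ 2 ∂μ) atTop (nhds 0) := by
    rw [Metric.tendsto_atTop']
    suffices hs : ∀ ε > 0, ∀ᶠ N in atTop, ∫ x, A N x ^ 2 ∂μ < ε by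
      intro ε hε
      obtain ⟨N₀, hN₀⟩ := eventually_atTop.1 (hs ε hε)
      refine ⟨N₀, fun n hn => ?_⟩
      rw [Real.dist_eq, sub_zero, abs_of_nonneg (integral_nonneg fun x => sq_nonneg _)]
      exact hN₀ n hn.le
    intro ε hε
    obtain ⟨ι, t, w, h, hw0, hw1, hlt⟩ := fca_ergodic ν S hSmp
      (fun y => funext fun i => hid i _) (fun n m y => funext fun i => hadd i n m _) Φ hΦm C hCprod
      (by
        intro g hg hgb hgi
        rw [← horth f hf hfb g hg hgb hgi]
        refine integral_congr_ae (ae_of_all _ fun y => ?_)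
        simp only [hsplit, Φ]) (ε / 4) (by positivity)
    -- limit of correlations
    have hcor : ∀ i j, Tendsto (fun N => ((I N).card : ℝ)⁻¹ *
        ∑ n ∈ I N, ∫ x, u (n + a N + h i) x * u (n + a N + h j) x ∂μ) atTop
        (nhds (∫ y, Φ (S (h i) y) * Φ (S (h j) y) ∂ν)) := by
      intro i j
      have h1 := hν (fun l x => F l (T l (h i) x) * F l (T l (h j) x))
        (fun l => ((hFm l).comp (hTm l _)).mul ((hFm l).comp (hTm l _)))
        (fun l => ⟨c l * c l, fun x => by
          rw [abs_mul]
          exact mul_le_mul (hc l _) (hc l _) (abs_nonneg _) ((abs_nonneg _).trans (hc l x))⟩)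
        I a hne hfol
      have h2 : ∀ y : Fin d → X, ∏ l, (F l (T l (h i) (y l)) * F l (T l (h j) (y l)))
          = Φ (S (h i) y) * Φ (S (h j) y) := fun y => Finset.prod_mul_distrib
      rw [integral_congr_ae (ae_of_all ν h2)] at h1
      refine h1.congr fun N => ?_
      congr 1
      refine Finset.sum_congr rfl fun n _ => ?_
      refine integral_congr_ae (ae_of_all _ fun x => ?_)
      have e3 : u (n + a N + h i) x * u (n + a N + h j) x
          = ∏ l, (F l (T l (n + a N + h i) x) * F l (T l (n + a N + h j) x)) :=
        Finset.prod_mul_distrib.symm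
      refine Eq.trans ?_ e3.symm
      refine Finset.prod_congr rfl fun l _ => ?_
      rw [← hadd, ← hadd, add_comm (h i), add_comm (h j)]
    have hQ : Tendsto (fun N => ((I N).card : ℝ)⁻¹ *
        ∑ n ∈ I N, ∫ x, (∑ i ∈ t, w i * u (n + a N + h i) x) ^ 2 ∂μ) atTop
        (nhds (∫ y, (∑ i ∈ t, w i * Φ (S (h i) y)) ^ 2 ∂ν)) := by
      have h1 := tendsto_finsetSum t fun i _ => tendsto_finsetSum t fun j _ =>
        (hcor i j).const_mul (w i * w j)
      have e1 : ∫ y, (∑ i ∈ t, w i * Φ (S (h i) y)) ^ 2 ∂ν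
          = ∑ i ∈ t, ∑ j ∈ t, w i * w j * ∫ y, Φ (S (h i) y) * Φ (S (h j) y) ∂ν := by
        have hi : ∀ i j, Integrable (fun y => Φ (S (h i) y) * Φ (S (h j) y)) ν := fun i j =>
          Integrable.of_bound ((hΦm.comp (hSmp _).measurable).mul
            (hΦm.comp (hSmp _).measurable)).aestronglyMeasurable (C * C) (ae_of_all _ fun y => by
              rw [Real.norm_eq_abs, abs_mul]
              exact mul_le_mul (hCprod _) (hCprod _) (abs_nonneg _)
                ((abs_nonneg _).trans (hCprod y)))
        calc _ = ∫ y, ∑ i ∈ t, ∑ j ∈ t, w i * w j * (Φ (S (h i) y) * Φ (S (h j) y)) ∂ν := by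
              refine integral_congr_ae (ae_of_all _ fun y => ?_)
              simp only [sq]
              rw [Finset.sum_mul_sum]
              exact Finset.sum_congr rfl fun i _ => Finset.sum_congr rfl fun j _ => by ring
          _ = _ := by
              rw [integral_finsetSum _ fun i _ => integrable_finsetSum _ fun j _ =>
                (hi i j).const_mul _]
              refine Finset.sum_congr rfl fun i _ => ?_
              rw [integral_finsetSum _ fun j _ => (hi i j).const_mul _]
              exact Finset.sum_congr rfl fun j _ => integral_const_mul _ _
      rw [e1]
      refine h1.congr fun N => ?_
      have e2 : ∀ m, ∫ x, (∑ i ∈ t, w i * u (m + h i) x) ^ 2 ∂μ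
          = ∑ i ∈ t, ∑ j ∈ t, w i * w j * ∫ x, u (m + h i) x * u (m + h j) x ∂μ := by
        intro m
        calc _ = ∫ x, ∑ i ∈ t, ∑ j ∈ t, w i * w j * (u (m + h i) x * u (m + h j) x) ∂μ := by
              refine integral_congr_ae (ae_of_all _ fun y => ?_)
              simp only [sq]
              rw [Finset.sum_mul_sum]
              exact Finset.sum_congr rfl fun i _ => Finset.sum_congr rfl fun j _ => by ring
          _ = _ := by
              rw [integral_finsetSum _ fun i _ => integrable_finsetSum _ fun j _ =>
                (huu _ _).const_mul _]
              refine Finset.sum_congr rfl fun i _ => ?_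
              rw [integral_finsetSum _ fun j _ => (huu _ _).const_mul _]
              exact Finset.sum_congr rfl fun j _ => integral_const_mul _ _
      simp only [e2]
      symm
      rw [Finset.sum_comm, Finset.mul_sum]
      refine Finset.sum_congr rfl fun i _ => ?_
      rw [Finset.sum_comm, Finset.mul_sum]
      refine Finset.sum_congr rfl fun j _ => ?_
      rw [← Finset.mul_sum]
      ring
    let δ : ℕ → ℝ := fun N => ∑ i ∈ t, w i *
      (C * (((((I N).image (· + h i)) ∆ (I N)).card : ℝ) / ((I N).card : ℝ)))
    have hδ : Tendsto δ atTop (nhds 0) := by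
      have := tendsto_finsetSum t fun i _ => ((hfol (h i)).const_mul C).const_mul (w i)
      simp only [mul_zero, Finset.sum_const_zero] at this
      exact this
    let B : ℕ → X → ℝ := fun N x => ((I N).card : ℝ)⁻¹ *
      ∑ n ∈ I N, ∑ i ∈ t, w i * u (n + a N + h i) x
    have hAB : ∀ N x, |A N x - B N x| ≤ δ N := by
      intro N x
      have e : A N x - B N x = ∑ i ∈ t, w i * (((I N).card : ℝ)⁻¹ *
          (∑ n ∈ I N, u (n + a N) x - ∑ n ∈ I N, u (n + h i + a N) x)) := by
        have e1 : A N x = ∑ i ∈ t, w i * A N x := by rw [← Finset.sum_mul, hw1, one_mul]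
        have e2 : B N x = ∑ i ∈ t, w i * (((I N).card : ℝ)⁻¹ *
            ∑ n ∈ I N, u (n + h i + a N) x) := by
          simp only [B]
          rw [Finset.sum_comm, Finset.mul_sum]
          refine Finset.sum_congr rfl fun i _ => ?_
          rw [← Finset.mul_sum, mul_left_comm]
          simp only [add_right_comm]
        rw [e1, e2, ← Finset.sum_sub_distrib]
        refine Finset.sum_congr rfl fun i _ => ?_
        simp only [A]
        ring
      rw [e]
      refine (Finset.abs_sum_le_sum_abs _ _).trans (Finset.sum_le_sum fun i hi => ?_)
      rw [abs_mul, abs_of_nonneg (hw0 i hi)]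
      refine mul_le_mul_of_nonneg_left ?_ (hw0 i hi)
      rw [abs_mul, abs_of_pos (inv_pos.2 (hIpos N)), inv_mul_le_iff₀ (hIpos N)]
      refine (fca_boundary (I N) (h i) (fun n => u (n + a N) x) C (fun n => hub _ x)).trans
        (le_of_eq ?_)
      have := (hIpos N).ne'
      field_simp
    have hqint : ∀ m, Integrable (fun x => (∑ i ∈ t, w i * u (m + h i) x) ^ 2) μ := by
      intro m
      have h1 : MemLp (fun x => ∑ i ∈ t, w i * u (m + h i) x) 2 μ :=
        memLp_finsetSum t fun i _ => (MemLp.of_bound (hum _).aestronglyMeasurable C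
          (ae_of_all _ (hub _))).const_mul (w i)
      exact h1.integrable_sq
    have hbound : ∀ N, ∫ x, A N x ^ 2 ∂μ ≤ 2 * δ N ^ 2 + 2 * (((I N).card : ℝ)⁻¹ *
        ∑ n ∈ I N, ∫ x, (∑ i ∈ t, w i * u (n + a N + h i) x) ^ 2 ∂μ) := by
      intro N
      have hp : ∀ x, A N x ^ 2 ≤ 2 * δ N ^ 2 + 2 * (((I N).card : ℝ)⁻¹ *
        ∑ n ∈ I N, (∑ i ∈ t, w i * u (n + a N + h i) x) ^ 2) := by
        intro x
        have h1 : (A N x - B N x) ^ 2 ≤ δ N ^ 2 := by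
          rw [← sq_abs]
          exact pow_le_pow_left₀ (abs_nonneg _) (hAB N x) 2
        have h2 : B N x ^ 2 ≤ ((I N).card : ℝ)⁻¹ *
            ∑ n ∈ I N, (∑ i ∈ t, w i * u (n + a N + h i) x) ^ 2 := by
          have h3 := sq_sum_le_card_mul_sum_sq (s := I N)
            (f := fun n => ∑ i ∈ t, w i * u (n + a N + h i) x)
          simp only [B]
          rw [mul_pow, le_inv_mul_iff₀ (hIpos N)]
          refine le_of_mul_le_mul_left ?_ (hIpos N)
          refine le_trans (le_of_eq ?_) h3
          have := (hIpos N).ne'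
          field_simp
        nlinarith [sq_nonneg (A N x - 2 * B N x)]
      have hi2 : Integrable (fun x => 2 * (((I N).card : ℝ)⁻¹ *
        ∑ n ∈ I N, (∑ i ∈ t, w i * u (n + a N + h i) x) ^ 2)) μ :=
        ((integrable_finsetSum _ fun n _ => hqint _).const_mul _).const_mul _
      refine (integral_mono (hAmem N).integrable_sq ((integrable_const _).add hi2) hp).trans
        (le_of_eq ?_)
      simp only [Pi.add_apply]
      rw [integral_add (integrable_const _) hi2, integral_const, integral_const_mul,
        integral_const_mul, integral_finsetSum _ fun n _ => hqint _]
      simp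
    have hlim := ((hδ.pow 2).const_mul 2).add (hQ.const_mul 2)
    have hlt' : 2 * (0 : ℝ) ^ 2 + 2 * ∫ y, (∑ i ∈ t, w i * Φ (S (h i) y)) ^ 2 ∂ν < ε := by
      linarith
    filter_upwards [hlim.eventually_lt_const hlt'] with N hN
    exact (hbound N).trans_lt hN
  have heq : ∀ N, eLpNorm (A N) 2 μ = ENNReal.ofReal ((∫ x, A N x ^ 2 ∂μ) ^ (2⁻¹ : ℝ)) := by
    intro N
    rw [(hAmem N).eLpNorm_eq_integral_rpow_norm two_ne_zero ENNReal.ofNat_ne_top]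
    simp
  simp only [heq]
  have := ENNReal.tendsto_ofReal (key.rpow_const (p := (2⁻¹ : ℝ)) (Or.inr (by norm_num)))
  simpa using this
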